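/- Let ν > η > 0 and μ := √(ν² − η²). Then for every x > μ, the derivative of ψlo_{ν,η} is given by ψlo'_{ν,η}(x) = (2x⁴ − x²(η(η + 2) + 4μ²) + μ²(η² + 2μ²))/(2x(x² − μ²)^{3/2}); moreover x#_{μ,η} > μ, ψlo'_{ν,η}(x#_{μ,η}) = 0, x#_{μ,η} is the only zero of ψlo'_{ν,η} in (μ, ∞), and ψlo'_{ν,η}(x) > 0 for all x > x#_{μ,η}. -/

import Mathlib

/-- The lower bound for the phase of ultraspherical Bessel derivatives: for `μ = √(ν² − η²)`,
`ψlo_{ν,η}(x) := √(x² − μ²) − (η²/(2μ) + μ)·arccos(μ/x) + η/√(x² − μ²)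
  + (π/4)(η²/μ + 2(μ − ν) + 1)`. -/
noncomputable def psiLo (ν η x : ℝ) : ℝ :=
  Real.sqrt (x ^ 2 - Real.sqrt (ν ^ 2 - η ^ 2) ^ 2)
    - (η ^ 2 / (2 * Real.sqrt (ν ^ 2 - η ^ 2)) + Real.sqrt (ν ^ 2 - η ^ 2))
      * Real.arccos (Real.sqrt (ν ^ 2 - η ^ 2) / x)
    + η / Real.sqrt (x ^ 2 - Real.sqrt (ν ^ 2 - η ^ 2) ^ 2)
    + (Real.pi / 4) * (η ^ 2 / Real.sqrt (ν ^ 2 - η ^ 2)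
      + 2 * (Real.sqrt (ν ^ 2 - η ^ 2) - ν) + 1)

/-- `x#_{μ,η} := (1/2)·√(4μ² + η(η + 2) + √(η²(η + 2)² + 16μ²η))`. -/
noncomputable def xSharp (μ η : ℝ) : ℝ :=
  (1 / 2) * Real.sqrt (4 * μ ^ 2 + η * (η + 2)
    + Real.sqrt (η ^ 2 * (η + 2) ^ 2 + 16 * μ ^ 2 * η))

theorem hasDerivAt_sqrt_sq_sub_sq {m x : ℝ} (h : 0 < x ^ 2 - m ^ 2) :
    HasDerivAt (fun y => Real.sqrt (y ^ 2 - m ^ 2)) (x / Real.sqrt (x ^ 2 - m ^ 2)) x := by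
  have h1 : HasDerivAt (fun y : ℝ => y ^ 2 - m ^ 2) (2 * x) x := by
    simpa using (hasDerivAt_pow 2 x).sub_const (m ^ 2)
  convert h1.sqrt h.ne' using 1
  rw [mul_div_mul_left _ _ two_ne_zero]

theorem hasDerivAt_arccos_div {m x : ℝ} (hm : 0 < m) (hx : m < x) :
    HasDerivAt (fun y => Real.arccos (m / y)) (m / (x * Real.sqrt (x ^ 2 - m ^ 2))) x := by
  have hx0 : 0 < x := hm.trans hx
  have hd : 0 < x ^ 2 - m ^ 2 := by nlinarith
  have hs : 0 < Real.sqrt (x ^ 2 - m ^ 2) := Real.sqrt_pos.2 hd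
  have hlt : m / x < 1 := (div_lt_one hx0).2 hx
  have hpos : 0 < m / x := div_pos hm hx0
  have h1 : HasDerivAt (fun y : ℝ => m / y) (-m / x ^ 2) x := by
    exact ((hasDerivAt_const x m).div (hasDerivAt_id x) hx0.ne').congr_deriv (by simp)
  have hsqrt : Real.sqrt (1 - (m / x) ^ 2) = Real.sqrt (x ^ 2 - m ^ 2) / x := by
    have h : 1 - (m / x) ^ 2 = (x ^ 2 - m ^ 2) / x ^ 2 := by field_simp
    rw [h, Real.sqrt_div hd.le, Real.sqrt_sq hx0.le]
  have h2 := (Real.hasDerivAt_arccos (by linarith : -1 < m / x).ne'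
    hlt.ne).comp x h1
  refine h2.congr_deriv ?_
  rw [hsqrt]
  field_simp

theorem hasDerivAt_psiLo {ν η x : ℝ} (hm : 0 < Real.sqrt (ν ^ 2 - η ^ 2))
    (hx : Real.sqrt (ν ^ 2 - η ^ 2) < x) :
    HasDerivAt (psiLo ν η)
      ((2 * x ^ 4
          - x ^ 2 * (η * (η + 2) + 4 * Real.sqrt (ν ^ 2 - η ^ 2) ^ 2)
          + Real.sqrt (ν ^ 2 - η ^ 2) ^ 2 * (η ^ 2 + 2 * Real.sqrt (ν ^ 2 - η ^ 2) ^ 2))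
        / (2 * x * Real.sqrt (x ^ 2 - Real.sqrt (ν ^ 2 - η ^ 2) ^ 2) ^ 3)) x := by
  unfold psiLo
  set m := Real.sqrt (ν ^ 2 - η ^ 2)
  have hx0 : 0 < x := hm.trans hx
  have hd : 0 < x ^ 2 - m ^ 2 := by nlinarith
  have hs : 0 < Real.sqrt (x ^ 2 - m ^ 2) := Real.sqrt_pos.2 hd
  have hsq : Real.sqrt (x ^ 2 - m ^ 2) ^ 2 = x ^ 2 - m ^ 2 := Real.sq_sqrt hd.le
  have h1 := hasDerivAt_sqrt_sq_sub_sq hd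
  have h2 := (hasDerivAt_arccos_div hm hx).const_mul (η ^ 2 / (2 * m) + m)
  have h3 := (hasDerivAt_const x η).div h1 hs.ne'
  have h := ((h1.sub h2).add h3).add_const
    ((Real.pi / 4) * (η ^ 2 / m + 2 * (m - ν) + 1))
  refine h.congr_deriv ?_
  set s := Real.sqrt (x ^ 2 - m ^ 2)
  field_simp
  linear_combination (2 * x ^ 2 - η ^ 2 - 2 * m ^ 2) * hsq

theorem sq_xSharp {η : ℝ} (μ : ℝ) (hη : 0 < η) :
    xSharp μ η ^ 2 = (4 * μ ^ 2 + η * (η + 2)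
      + Real.sqrt (η ^ 2 * (η + 2) ^ 2 + 16 * μ ^ 2 * η)) / 4 := by
  rw [xSharp, mul_pow, Real.sq_sqrt (by positivity)]
  ring

theorem lt_sqrt_discriminant {μ η : ℝ} (hμ : 0 < μ) (hη : 0 < η) :
    η * (η + 2) < Real.sqrt (η ^ 2 * (η + 2) ^ 2 + 16 * μ ^ 2 * η) := by
  apply Real.lt_sqrt_of_sq_lt
  have : 0 < 16 * μ ^ 2 * η := by positivity
  linarith [mul_pow η (η + 2) 2]

theorem lt_xSharp {μ η : ℝ} (hμ : 0 < μ) (hη : 0 < η) : μ < xSharp μ η := by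
  refine lt_of_pow_lt_pow_left₀ 2 (by unfold xSharp; positivity) ?_
  rw [sq_xSharp μ hη]
  have : 0 < η * (η + 2) := by positivity
  linarith [lt_sqrt_discriminant hμ hη]

theorem psiLo_deriv_numerator_factor {η : ℝ} (μ x : ℝ) (hη : 0 < η) :
    2 * x ^ 4 - x ^ 2 * (η * (η + 2) + 4 * μ ^ 2) + μ ^ 2 * (η ^ 2 + 2 * μ ^ 2)
      = 2 * (x ^ 2 - xSharp μ η ^ 2) * (x ^ 2 - (4 * μ ^ 2 + η * (η + 2)
        - Real.sqrt (η ^ 2 * (η + 2) ^ 2 + 16 * μ ^ 2 * η)) / 4) := by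
  have h : Real.sqrt (η ^ 2 * (η + 2) ^ 2 + 16 * μ ^ 2 * η) ^ 2
      = η ^ 2 * (η + 2) ^ 2 + 16 * μ ^ 2 * η := Real.sq_sqrt (by positivity)
  rw [sq_xSharp μ hη]
  linear_combination (1 / 8) * h

/-- The explicit formula for `ψlo'_{ν,η}`, together with the facts that `x#_{μ,η} > μ`,
`x#_{μ,η}` is the unique zero of `ψlo'_{ν,η}` in `(μ, ∞)`, and `ψlo'_{ν,η} > 0` on
`(x#_{μ,η}, ∞)`. -/
theorem psiLo_deriv_formula_and_xSharp (ν η : ℝ) (hη : 0 < η) (hν : η < ν) :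
    (∀ x, Real.sqrt (ν ^ 2 - η ^ 2) < x →
      deriv (psiLo ν η) x
        = (2 * x ^ 4
            - x ^ 2 * (η * (η + 2) + 4 * Real.sqrt (ν ^ 2 - η ^ 2) ^ 2)
            + Real.sqrt (ν ^ 2 - η ^ 2) ^ 2 * (η ^ 2 + 2 * Real.sqrt (ν ^ 2 - η ^ 2) ^ 2))
          / (2 * x * Real.sqrt (x ^ 2 - Real.sqrt (ν ^ 2 - η ^ 2) ^ 2) ^ 3)) ∧
    Real.sqrt (ν ^ 2 - η ^ 2) < xSharp (Real.sqrt (ν ^ 2 - η ^ 2)) η ∧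
    deriv (psiLo ν η) (xSharp (Real.sqrt (ν ^ 2 - η ^ 2)) η) = 0 ∧
    (∀ x, Real.sqrt (ν ^ 2 - η ^ 2) < x → deriv (psiLo ν η) x = 0 →
      x = xSharp (Real.sqrt (ν ^ 2 - η ^ 2)) η) ∧
    (∀ x, xSharp (Real.sqrt (ν ^ 2 - η ^ 2)) η < x → 0 < deriv (psiLo ν η) x) := by
  have hm : 0 < Real.sqrt (ν ^ 2 - η ^ 2) := Real.sqrt_pos.2 (by nlinarith)
  have hderiv := fun x hx => (hasDerivAt_psiLo (ν := ν) (η := η) (x := x) hm hx).deriv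
  have hlt := lt_xSharp hm hη
  have hR := lt_sqrt_discriminant hm hη
  have hfac := fun x => psiLo_deriv_numerator_factor (Real.sqrt (ν ^ 2 - η ^ 2)) x hη
  set m := Real.sqrt (ν ^ 2 - η ^ 2)
  have hsmall : ∀ x, m < x → 0 < x ^ 2 - (4 * m ^ 2 + η * (η + 2)
      - Real.sqrt (η ^ 2 * (η + 2) ^ 2 + 16 * m ^ 2 * η)) / 4 := by
    intro x hx
    have : m ^ 2 < x ^ 2 := pow_lt_pow_left₀ hx hm.le two_ne_zero
    linarith
  have hden : ∀ x, m < x → 0 < 2 * x * Real.sqrt (x ^ 2 - m ^ 2) ^ 3 := by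
    intro x hx
    have hx0 : 0 < x := hm.trans hx
    have : 0 < Real.sqrt (x ^ 2 - m ^ 2) := Real.sqrt_pos.2 (by nlinarith)
    positivity
  have hx0 : 0 < xSharp m η := hm.trans hlt
  refine ⟨hderiv, hlt, ?_, fun x hx h => ?_, fun x hx => ?_⟩
  · rw [hderiv _ hlt, hfac]
    simp
  · rw [hderiv x hx, hfac, div_eq_zero_iff, or_iff_left (hden x hx).ne', mul_eq_zero,
      or_iff_left (hsmall x hx).ne', mul_eq_zero, or_iff_right two_ne_zero, sub_eq_zero] at h
    exact (pow_left_inj₀ (hm.trans hx).le hx0.le two_ne_zero).1 h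
  · have hmx := hlt.trans hx
    rw [hderiv x hmx, hfac]
    have : xSharp m η ^ 2 < x ^ 2 := pow_lt_pow_left₀ hx hx0.le two_ne_zero
    exact div_pos (mul_pos (mul_pos two_pos (sub_pos.2 this)) (hsmall x hmx)) (hden x hmx)
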